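/- Let H be an infinite-dimensional complex Hilbert space, let r and s be positive rational numbers with r + s > 1, and let φ : S(H) → S(H) be a surjective map satisfying σ(|A|^r B |A|^s) = σ(|φ(A)|^r φ(B) |φ(A)|^s) for every A in P₁(H) ∪ {I} and every B ∈ S(H). Then φ is additive: φ(B + B') = φ(B) + φ(B') for all B, B' ∈ S(H). -/

import Mathlib

/-- The absolute value `|A| = (A* A)^(1/2)`, via the continuous functional calculus. -/
noncomputable def absOp {H : Type*} [NormedAddCommGroup H] [InnerProductSpace ℂ H]
    [CompleteSpace H] (A : H →L[ℂ] H) : H →L[ℂ] H :=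
  cfc (fun t : ℝ => Real.sqrt t) (star A * A)

/-- The power `|A|^r`, via the continuous functional calculus. -/
noncomputable def absPow {H : Type*} [NormedAddCommGroup H] [InnerProductSpace ℂ H]
    [CompleteSpace H] (A : H →L[ℂ] H) (r : ℝ) : H →L[ℂ] H :=
  cfc (fun t : ℝ => t ^ r) (absOp A)

/-- An operator has rank one when its range is a one-dimensional subspace. -/
def IsRankOne {H : Type*} [NormedAddCommGroup H] [InnerProductSpace ℂ H]
    (A : H →L[ℂ] H) : Prop :=
  Module.finrank ℂ (LinearMap.range (A : H →ₗ[ℂ] H)) = 1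

/-- A rank-one projection: a self-adjoint idempotent of rank one. -/
def IsRankOneProjection {H : Type*} [NormedAddCommGroup H] [InnerProductSpace ℂ H]
    [CompleteSpace H] (A : H →L[ℂ] H) : Prop :=
  IsSelfAdjoint A ∧ A * A = A ∧ IsRankOne A

open scoped InnerProductSpace


section aux
variable {H : Type*} [NormedAddCommGroup H] [InnerProductSpace ℂ H]

lemma aux_eig (C : H →L[ℂ] H) (v : H) (hv : v ≠ 0) (c : ℂ) (h : C v = c • v) :
    c ∈ spectrum ℂ C := by
  rw [spectrum.mem_iff]
  rintro ⟨u, hu⟩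
  apply hv
  have h1 : (algebraMap ℂ (H →L[ℂ] H) c - C) v = 0 := by
    simp [Algebra.algebraMap_eq_smul_one, h]
  rw [← hu] at h1
  have h2 : ((↑u⁻¹ : H →L[ℂ] H) * (u : H →L[ℂ] H)) v = 0 := by
    rw [ContinuousLinearMap.mul_apply, h1, map_zero]
  simpa using h2

noncomputable def pr (x : H) : H →L[ℂ] H := InnerProductSpace.rankOne ℂ x x

lemma pr_apply (x v : H) : pr x v = ⟪x, v⟫_ℂ • x := rfl

lemma inner_unit {x : H} (hx : ‖x‖ = 1) : ⟪x, x⟫_ℂ = 1 := by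
  rw [inner_self_eq_norm_sq_to_K, hx]; simp

lemma pr_self {x : H} (hx : ‖x‖ = 1) : pr x x = x := by
  rw [pr_apply, inner_unit hx, one_smul]

lemma pr_idem {x : H} (hx : ‖x‖ = 1) : pr x * pr x = pr x :=
  InnerProductSpace.isIdempotentElem_rankOne_self hx

lemma exists_orth (hH : ¬ FiniteDimensional ℂ H) (x : H) : ∃ v : H, v ≠ 0 ∧ ⟪x, v⟫_ℂ = 0 := by
  by_contra! hc
  apply hH
  have h : (Submodule.span ℂ {x})ᗮ = ⊥ := by
    rw [Submodule.eq_bot_iff]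
    intro v hv
    by_contra h0
    exact hc v h0 ((Submodule.mem_orthogonal_singleton_iff_inner_right).1 hv)
  rw [Submodule.orthogonal_eq_bot_iff] at h
  have : FiniteDimensional ℂ (⊤ : Submodule ℂ H) := by rw [← h]; infer_instance
  exact Module.finite_def.2 (Module.Finite.iff_fg.1 this)

lemma pr_mul (x : H) (B : H →L[ℂ] H) : pr x * B * pr x = ⟪x, B x⟫_ℂ • pr x := by
  ext v
  simp [pr_apply, smul_smul, mul_comm]

lemma spec_pr (hH : ¬ FiniteDimensional ℂ H) {x : H} (hx : ‖x‖ = 1) (B : H →L[ℂ] H) :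
    spectrum ℂ (pr x * B * pr x) = {0, ⟪x, B x⟫_ℂ} := by
  have hx0 : x ≠ 0 := by rintro rfl; simp at hx
  have : Nontrivial H := ⟨x, 0, hx0⟩
  rw [pr_mul]
  apply Set.Subset.antisymm
  · have h1 : (1 : ℂ) ∈ spectrum ℂ (pr x) := aux_eig _ x hx0 1 (by rw [pr_self hx, one_smul])
    rw [spectrum.smul_eq_smul _ _ ⟨1, h1⟩]
    rintro _ ⟨t, ht, rfl⟩
    have := IsIdempotentElem.spectrum_subset ℂ (p := pr x) (pr_idem hx) ht
    rcases this with rfl | rfl <;> simp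
  · rintro t (rfl | rfl)
    · obtain ⟨v, hv, hv'⟩ := exists_orth hH x
      exact aux_eig _ v hv 0 (by simp [pr_apply, hv'])
    · exact aux_eig _ x hx0 _ (by simp [pr_self hx])

variable [CompleteSpace H]

lemma pr_sa (x : H) : IsSelfAdjoint (pr x) := by
  rw [ContinuousLinearMap.isSelfAdjoint_iff_isSymmetric]
  exact InnerProductSpace.isSymmetric_rankOne_self x

lemma pr_rank {x : H} (hx : ‖x‖ = 1) : IsRankOneProjection (pr x) := by
  refine ⟨pr_sa x, pr_idem hx, ?_⟩
  have hx0 : x ≠ 0 := by rintro rfl; simp at hx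
  have : LinearMap.range (pr x : H →ₗ[ℂ] H) = Submodule.span ℂ {x} := by
    ext v
    rw [LinearMap.mem_range, Submodule.mem_span_singleton]
    constructor
    · rintro ⟨w, rfl⟩; exact ⟨_, rfl⟩
    · rintro ⟨c, rfl⟩
      refine ⟨c • x, ?_⟩
      simp [pr_self hx]
  unfold IsRankOne
  rw [this]
  exact finrank_span_singleton hx0

lemma absPow_eq (T : H →L[ℂ] H) (hT : IsSelfAdjoint T) (r : ℝ) (hr : 0 < r) :
    absPow T r = cfc (fun t : ℝ => |t| ^ r) T := by
  have h1 : absOp T = cfc (fun t : ℝ => |t|) T := by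
    unfold absOp
    rw [hT.star_eq, ← pow_two, ← cfc_comp_pow (R := ℝ) (fun t => Real.sqrt t) 2 T
      (by fun_prop) hT]
    simp [Real.sqrt_sq_eq_abs]
  unfold absPow
  rw [h1, ← cfc_comp' (fun t : ℝ => t ^ r) (fun t : ℝ => |t|) T
    (Real.continuous_rpow_const hr.le).continuousOn (by fun_prop) hT]

lemma absPow_proj (T : H →L[ℂ] H) (hT : IsSelfAdjoint T) (h2 : T * T = T) (r : ℝ) (hr : 0 < r) :
    absPow T r = T := by
  rw [absPow_eq T hT r hr]
  conv_rhs => rw [← cfc_id' ℝ T hT]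
  apply cfc_congr
  intro t ht
  rcases IsIdempotentElem.spectrum_subset ℝ (p := T) h2 ht with rfl | rfl
  · simp [hr.ne']
  · simp

lemma idem_of_spec (T : H →L[ℂ] H) (hT : IsSelfAdjoint T) (h : spectrum ℂ T ⊆ {0, 1}) :
    T * T = T := by
  rw [← pow_two, ← cfc_pow_id (R := ℝ) T 2 hT]
  conv_rhs => rw [← cfc_id' ℝ T hT]
  apply cfc_congr
  intro t ht
  have := h ((spectrum.algebraMap_mem_iff ℂ).2 ht)
  rcases this with h | h
  · have : t = 0 := by simpa using h
    simp [this]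
  · have : t = 1 := by simpa using h
    simp [this]

lemma eq_one_of_spec (T : H →L[ℂ] H) (hT : IsSelfAdjoint T) (r s : ℝ) (hr : 0 < r) (hs : 0 < s)
    (h : spectrum ℂ (absPow T r * T * absPow T s) = {1}) : T = 1 := by
  have hc : ∀ r : ℝ, 0 < r → Continuous (fun t : ℝ => |t| ^ r) := fun r hr =>
    (Real.continuous_rpow_const hr.le).comp continuous_abs
  have e : absPow T r * T * absPow T s = cfc (fun t : ℝ => |t| ^ r * t * |t| ^ s) T := by
    rw [cfc_mul (fun t : ℝ => |t| ^ r * t) (fun t : ℝ => |t| ^ s) T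
      ((hc r hr).mul continuous_id).continuousOn (hc s hs).continuousOn,
      cfc_mul (fun t : ℝ => |t| ^ r) (fun t : ℝ => t) T (hc r hr).continuousOn
      continuousOn_id, cfc_id' ℝ T hT, absPow_eq T hT r hr, absPow_eq T hT s hs]
  rw [← cfc_id' ℝ T hT, ← cfc_const_one ℝ T hT]
  apply cfc_congr
  intro t ht
  have h1 : |t| ^ r * t * |t| ^ s ∈ spectrum ℝ (absPow T r * T * absPow T s) := by
    rw [e, cfc_map_spectrum (R := ℝ) (fun t : ℝ => |t| ^ r * t * |t| ^ s) T hT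
      (((hc r hr).mul continuous_id).mul (hc s hs)).continuousOn]
    exact ⟨t, ht, rfl⟩
  have h2 := (spectrum.algebraMap_mem_iff ℂ).2 h1
  rw [h] at h2
  have h3 : |t| ^ r * t * |t| ^ s = 1 := by
    have h4 : ((|t| ^ r * t * |t| ^ s : ℝ) : ℂ) = 1 := h2
    exact_mod_cast h4
  have ht0 : 0 < t := by
    by_contra hn
    have := mul_nonneg (Real.rpow_nonneg (abs_nonneg t) r) (Real.rpow_nonneg (abs_nonneg t) s)
    nlinarith
  rw [abs_of_pos ht0] at h3
  show t = 1
  rcases lt_trichotomy t 1 with hl | hl | hl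
  · have a := Real.rpow_lt_one ht0.le hl hr
    have b := Real.rpow_lt_one ht0.le hl hs
    have a' := Real.rpow_pos_of_pos ht0 r
    have b' := Real.rpow_pos_of_pos ht0 s
    have : t ^ r * t < 1 := by nlinarith
    nlinarith [mul_pos a' ht0]
  · exact hl
  · have a := Real.one_lt_rpow hl hr
    have b := Real.one_lt_rpow hl hs
    have : 1 < t ^ r * t := by nlinarith
    nlinarith

lemma exists_unit (T : H →L[ℂ] H) (h2 : T * T = T) (h0 : T ≠ 0) :
    ∃ x : H, ‖x‖ = 1 ∧ T x = x := by
  obtain ⟨w, hw⟩ : ∃ w, T w ≠ 0 := by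
    by_contra! hc
    exact h0 (by ext v; simpa using hc v)
  refine ⟨((‖T w‖⁻¹ : ℝ) : ℂ) • T w, ?_, ?_⟩
  · rw [norm_smul]; simp [hw]
  · rw [map_smul, ← ContinuousLinearMap.mul_apply, h2]

/-- a projection all of whose compressions have two-point spectrum is rank one -/
lemma proj_rank (Q : H →L[ℂ] H) (hQ : IsSelfAdjoint Q) (h2 : Q * Q = Q) (h0 : Q ≠ 0)
    (h : ∀ C : H →L[ℂ] H, IsSelfAdjoint C → ∃ c : ℂ, spectrum ℂ (Q * C * Q) = {0, c}) :
    ∃ z : H, ‖z‖ = 1 ∧ Q = pr z := by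
  obtain ⟨z, hz, hQz⟩ := exists_unit Q h2 h0
  refine ⟨z, hz, ?_⟩
  by_contra hne
  have hsym : ∀ a b : H, ⟪Q a, b⟫_ℂ = ⟪a, Q b⟫_ℂ :=
    (ContinuousLinearMap.isSelfAdjoint_iff_isSymmetric.1 hQ)
  have hQQ : ∀ v, Q (Q v) = Q v := fun v => by rw [← ContinuousLinearMap.mul_apply, h2]
  obtain ⟨w, hw⟩ : ∃ w, Q w - pr z w ≠ 0 := by
    by_contra! hc
    exact hne (by ext v; exact sub_eq_zero.1 (hc v))
  have hz0 : z ≠ 0 := by rintro rfl; simp at hz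
  set u := Q w - pr z w with hu
  have hQu : Q u = u := by rw [hu, map_sub, hQQ, pr_apply, map_smul, hQz]
  have hzu : ⟪z, u⟫_ℂ = 0 := by
    rw [hu, inner_sub_right, ← hsym, hQz, pr_apply, inner_smul_right, inner_unit hz]; simp
  have huz : ⟪u, z⟫_ℂ = 0 := by rw [← inner_conj_symm, hzu, map_zero]
  -- the operator
  obtain ⟨c, hc⟩ := h (1 + pr z) ((IsSelfAdjoint.one _).add (pr_sa z))
  have m1 : (1 : ℂ) ∈ spectrum ℂ (Q * (1 + pr z) * Q) :=
    aux_eig _ u hw 1 (by simp [hQu, pr_apply, hzu])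
  have m2 : (2 : ℂ) ∈ spectrum ℂ (Q * (1 + pr z) * Q) :=
    aux_eig _ z hz0 2 (by simp [hQz, pr_self hz, two_smul])
  rw [hc] at m1 m2
  simp at m1 m2
  rw [← m1] at m2
  norm_num at m2

end aux

theorem preserver_additive
    {H : Type*} [NormedAddCommGroup H] [InnerProductSpace ℂ H] [CompleteSpace H]
    (hH : ¬ FiniteDimensional ℂ H)
    (r s : ℚ) (hr : 0 < r) (hs : 0 < s) (hrs : 1 < r + s)
    (φ : selfAdjoint (H →L[ℂ] H) → selfAdjoint (H →L[ℂ] H))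
    (hφ : Function.Surjective φ)
    (hspec : ∀ A : selfAdjoint (H →L[ℂ] H),
      (IsRankOneProjection (A : H →L[ℂ] H) ∨ (A : H →L[ℂ] H) = 1) →
      ∀ B : selfAdjoint (H →L[ℂ] H),
        spectrum ℂ (absPow (A : H →L[ℂ] H) r * (B : H →L[ℂ] H) * absPow (A : H →L[ℂ] H) s) =
        spectrum ℂ (absPow (φ A : H →L[ℂ] H) r * (φ B : H →L[ℂ] H) *
          absPow (φ A : H →L[ℂ] H) s)):
    ∀ B B' : selfAdjoint (H →L[ℂ] H), φ (B + B') = φ B + φ B'  := by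
  have hr' : (0 : ℝ) < (r : ℝ) := by exact_mod_cast hr
  have hs' : (0 : ℝ) < (s : ℝ) := by exact_mod_cast hs
  have hnt : Nontrivial H := by
    obtain ⟨v, hv, -⟩ := exists_orth hH (0 : H)
    exact ⟨v, 0, hv⟩
  have a1 : ∀ t : ℝ, 0 < t → absPow (1 : H →L[ℂ] H) t = 1 := fun t ht =>
    absPow_proj (1 : H →L[ℂ] H) (IsSelfAdjoint.one _) (one_mul _) t ht
  have h1 : ((φ 1 : selfAdjoint (H →L[ℂ] H)) : H →L[ℂ] H) = 1 := by
    have := hspec 1 (Or.inr rfl) 1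
    rw [selfAdjoint.val_one, a1 _ hr', a1 _ hs', mul_one, mul_one, spectrum.one_eq] at this
    exact eq_one_of_spec _ (φ 1).2 r s hr' hs' this.symm
  have hsp : ∀ B : selfAdjoint (H →L[ℂ] H),
      spectrum ℂ (B : H →L[ℂ] H) = spectrum ℂ (φ B : H →L[ℂ] H) := by
    intro B
    have := hspec 1 (Or.inr rfl) B
    rwa [h1, selfAdjoint.val_one, a1 _ hr', a1 _ hs', mul_one, one_mul, mul_one, one_mul] at this
  have hpr1 : ∀ x : H, ‖x‖ = 1 → (1 : ℂ) ∈ spectrum ℂ (pr x) := fun x hx =>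
    aux_eig _ x (by rintro rfl; simp at hx) 1 (by rw [pr_self hx, one_smul])
  -- images of rank one projections
  have key : ∀ x : H, ‖x‖ = 1 → ∃ z : H, ‖z‖ = 1 ∧
      (φ ⟨pr x, pr_sa x⟩ : H →L[ℂ] H) = pr z ∧
      ∀ B : selfAdjoint (H →L[ℂ] H),
        ⟪x, (B : H →L[ℂ] H) x⟫_ℂ = ⟪z, (φ B : H →L[ℂ] H) z⟫_ℂ := by
    intro x hx
    set Q := φ ⟨pr x, pr_sa x⟩ with hQ
    have hQs : spectrum ℂ (pr x) = spectrum ℂ (Q : H →L[ℂ] H) := hsp ⟨pr x, pr_sa x⟩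
    have hQ2 : (Q : H →L[ℂ] H) * Q = Q := idem_of_spec _ Q.2
      (hQs ▸ IsIdempotentElem.spectrum_subset ℂ (p := pr x) (pr_idem hx))
    have hQ0 : (Q : H →L[ℂ] H) ≠ 0 := by
      intro h0
      have := hpr1 x hx
      rw [hQs, h0, spectrum.zero_eq] at this
      simp at this
    have hB : ∀ B : selfAdjoint (H →L[ℂ] H),
        spectrum ℂ ((Q : H →L[ℂ] H) * (φ B : H →L[ℂ] H) * Q)
          = {0, ⟪x, (B : H →L[ℂ] H) x⟫_ℂ} := by
      intro B
      have := hspec ⟨pr x, pr_sa x⟩ (Or.inl (pr_rank hx)) B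
      rw [← hQ, absPow_proj _ Q.2 hQ2 _ hr', absPow_proj _ Q.2 hQ2 _ hs',
        absPow_proj _ (pr_sa x) (pr_idem hx) _ hr', absPow_proj _ (pr_sa x) (pr_idem hx) _ hs',
        spec_pr hH hx] at this
      exact this.symm
    obtain ⟨z, hz, hQz⟩ := proj_rank (Q : H →L[ℂ] H) Q.2 hQ2 hQ0 (by
      intro C hC
      obtain ⟨B, hBC⟩ := hφ ⟨C, hC⟩
      have := hB B
      rw [hBC] at this
      exact ⟨_, this⟩)
    refine ⟨z, hz, hQz, fun B => ?_⟩
    have := hB B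
    rw [hQz, spec_pr hH hz] at this
    have m1 : ⟪z, (φ B : H →L[ℂ] H) z⟫_ℂ ∈ ({0, ⟪x, (B : H →L[ℂ] H) x⟫_ℂ} : Set ℂ) := by
      rw [← this]; simp
    have m2 : ⟪x, (B : H →L[ℂ] H) x⟫_ℂ ∈ ({0, ⟪z, (φ B : H →L[ℂ] H) z⟫_ℂ} : Set ℂ) := by
      rw [this]; simp
    rcases m1 with m1 | m1
    · rcases m2 with m2 | m2
      · rw [m1, m2]
      · exact m2
    · exact m1.symm
  -- every unit vector is reached
  have reach : ∀ y : H, ‖y‖ = 1 → ∃ x : H, ∀ B : selfAdjoint (H →L[ℂ] H),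
        ⟪x, (B : H →L[ℂ] H) x⟫_ℂ = ⟪y, (φ B : H →L[ℂ] H) y⟫_ℂ := by
    intro y hy
    obtain ⟨R, hR⟩ := hφ ⟨pr y, pr_sa y⟩
    have hRs := hsp R
    rw [hR] at hRs
    change spectrum ℂ (R : H →L[ℂ] H) = spectrum ℂ (pr y) at hRs
    have hR2 : (R : H →L[ℂ] H) * R = R := idem_of_spec _ R.2
      (hRs ▸ IsIdempotentElem.spectrum_subset ℂ (p := pr y) (pr_idem hy))
    have hR0 : (R : H →L[ℂ] H) ≠ 0 := by
      intro h0
      have := hpr1 y hy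
      rw [← hRs, h0, spectrum.zero_eq] at this
      simp at this
    obtain ⟨x, hx, hRx⟩ := exists_unit _ hR2 hR0
    obtain ⟨z, hz, -, hzB⟩ := key x hx
    have hRz := hzB R
    rw [hRx, inner_unit hx, hR] at hRz
    change 1 = ⟪z, pr y z⟫_ℂ at hRz
    rw [pr_apply, inner_smul_right] at hRz
    -- y is a multiple of z
    have hyz : y = ⟪z, y⟫_ℂ • z := by
      have h0 : ⟪y - ⟪z, y⟫_ℂ • z, y - ⟪z, y⟫_ℂ • z⟫_ℂ = 0 := by
        simp only [inner_sub_left, inner_sub_right, inner_smul_left, inner_smul_right,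
          inner_unit hz, inner_unit hy, inner_conj_symm]
        linear_combination hRz
      exact sub_eq_zero.1 (inner_self_eq_zero.1 h0)
    refine ⟨x, fun B => ?_⟩
    rw [hzB B]
    have e : ⟪y, (φ B : H →L[ℂ] H) y⟫_ℂ
        = ⟪y, z⟫_ℂ * ⟪z, y⟫_ℂ * ⟪z, (φ B : H →L[ℂ] H) z⟫_ℂ := by
      conv_lhs => rw [hyz]
      rw [map_smul, inner_smul_left, inner_smul_right, inner_conj_symm]
      ring
    rw [e, ← hRz, one_mul]
  intro B B'
  apply Subtype.ext
  have hunit : ∀ y : H, ‖y‖ = 1 →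
      ⟪y, (φ (B + B') : H →L[ℂ] H) y⟫_ℂ = ⟪y, ((φ B + φ B' : selfAdjoint (H →L[ℂ] H)) : H →L[ℂ] H) y⟫_ℂ := by
    intro y hy
    obtain ⟨x, hx⟩ := reach y hy
    rw [← hx (B + B')]
    simp [inner_add_right, hx]
  have hall : ∀ v : H,
      ⟪v, ((φ (B + B') : H →L[ℂ] H) - ((φ B + φ B' : selfAdjoint (H →L[ℂ] H)) : H →L[ℂ] H)) v⟫_ℂ = 0 := by
    intro v
    by_cases hv : v = 0
    · simp [hv]
    have := hunit (((‖v‖⁻¹ : ℝ) : ℂ) • v) (by rw [norm_smul]; simp [hv])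
    rw [map_smul, map_smul, inner_smul_left, inner_smul_left, inner_smul_right,
      inner_smul_right] at this
    have hn : ((‖v‖⁻¹ : ℝ) : ℂ) ≠ 0 := by simp [hv]
    have hn' : (starRingEnd ℂ) ((‖v‖⁻¹ : ℝ) : ℂ) ≠ 0 := by simp [hv]
    have := mul_left_cancel₀ hn (mul_left_cancel₀ hn' this)
    rw [ContinuousLinearMap.sub_apply, inner_sub_right, this, sub_self]
  rw [← sub_eq_zero]
  have := (inner_map_self_eq_zero ((((φ (B + B') : H →L[ℂ] H) - ((φ B + φ B' : selfAdjoint (H →L[ℂ] H)) : H →L[ℂ] H)) : H →ₗ[ℂ] H))).1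
    (fun v => by rw [← inner_conj_symm]; exact (congrArg _ (hall v)).trans (map_zero _))
  ext v
  exact congrArg (fun f : H →ₗ[ℂ] H => f v) this
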